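/- arXiv:2206.07346 — 2 statements merged into one kernel-verified Lean document; each statement's English description precedes it below -/
import Mathlib

section
/- Let d ≥ 2 and for c > 0 define m_c = inf{E(u) : u ∈ H^1(R^d×T), ‖u‖_2^2 = c, K(u) = 0} and m̃_c = inf{I(u) : u ∈ H^1(R^d×T), ‖u‖_2^2 = c, K(u) ≤ 0}, where I(u) = (1/2)‖∂_y u‖_2^2 + (1/(2(d+1)))‖u‖_{2+4/(d−1)}^{2+4/(d−1)} = E(u) − (1/2)K(u). Then m_c = m̃_c. -/
open MeasureTheory Real Set

noncomputable section

abbrev Edim (d : ℕ) := EuclideanSpace ℝ (Fin d)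

/-- A fundamental domain `ℝ^d × (0, 2π]` representing `ℝ^d × 𝕋`. -/
def strip (d : ℕ) : Set (Edim d × ℝ) := Set.univ ×ˢ Set.Ioc 0 (2 * π)

/-- `M(u) = ‖u‖₂²` over `ℝ^d × 𝕋`. -/
def massF (d : ℕ) (u : Edim d × ℝ → ℂ) : ℝ := ∫ z in strip d, ‖u z‖ ^ 2

/-- `‖∇ₓ u‖₂²` over `ℝ^d × 𝕋`. -/
def gradxSq (d : ℕ) (u : Edim d × ℝ → ℂ) : ℝ :=
  ∫ z in strip d, ∑ i : Fin d, ‖fderiv ℝ u z (EuclideanSpace.single i 1, 0)‖ ^ 2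

/-- `‖∂_y u‖₂²` over `ℝ^d × 𝕋`. -/
def gradySq (d : ℕ) (u : Edim d × ℝ → ℂ) : ℝ :=
  ∫ z in strip d, ‖fderiv ℝ u z (0, 1)‖ ^ 2

/-- `‖u‖_p^p` over `ℝ^d × 𝕋`. -/
def lpPow (d : ℕ) (u : Edim d × ℝ → ℂ) (p : ℝ) : ℝ := ∫ z in strip d, ‖u z‖ ^ p

/-- The exponent `2 + 4/(d-1)`. -/
def qExp (d : ℕ) : ℝ := 2 + 4 / ((d : ℝ) - 1)

/-- The energy `E(u)`. -/
def energyF (d : ℕ) (u : Edim d × ℝ → ℂ) : ℝ :=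
  (1 / 2) * (gradxSq d u + gradySq d u)
    - (((d : ℝ) - 1) / (2 * ((d : ℝ) + 1))) * lpPow d u (qExp d)

/-- The semivirial `K(u)`. -/
def KF (d : ℕ) (u : Edim d × ℝ → ℂ) : ℝ :=
  gradxSq d u - ((d : ℝ) / ((d : ℝ) + 1)) * lpPow d u (qExp d)

/-- The functional `I(u)`. -/
def IF (d : ℕ) (u : Edim d × ℝ → ℂ) : ℝ :=
  (1 / 2) * gradySq d u + (1 / (2 * ((d : ℝ) + 1))) * lpPow d u (qExp d)

/-- Membership in `H¹(ℝ^d × 𝕋)`: `2π`-periodicity in `y`, differentiability, and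
integrability of `|u|²`, `|∇u|²` and `|u|^q` on a fundamental domain. -/
def InH1 (d : ℕ) (u : Edim d × ℝ → ℂ) : Prop :=
  (∀ x y, u (x, y + 2 * π) = u (x, y)) ∧ Differentiable ℝ u ∧
  IntegrableOn (fun z => ‖u z‖ ^ 2) (strip d) ∧
  IntegrableOn (fun z => ‖fderiv ℝ u z‖ ^ 2) (strip d) ∧
  IntegrableOn (fun z => ‖u z‖ ^ qExp d) (strip d)

/-- `m_c`, the infimum of the energy on the semivirial-vanishing manifold with mass `c`. -/
def mGround (d : ℕ) (c : ℝ) : ℝ :=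
  sInf {e | ∃ u, InH1 d u ∧ massF d u = c ∧ KF d u = 0 ∧ energyF d u = e}

end

noncomputable section

/-- Le Coz's relaxed variational problem `m̃_c = inf{I(u) : M(u) = c, K(u) ≤ 0}`. -/
def mTilde (d : ℕ) (c : ℝ) : ℝ :=
  sInf {e | ∃ u, InH1 d u ∧ massF d u = c ∧ KF d u ≤ 0 ∧ IF d u = e}

theorem ae_eq_zero_of_lintegral_ne_top_of_shift {Z : Type*} [MeasurableSpace Z] {μ : Measure Z}
    {T : Z → Z} (hT : MeasurePreserving T μ μ) {h : Z → ℝ} (hh : Measurable h)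
    (hhT : ∀ z, h (T z) = h z + 1) {f : Z → ENNReal} (hf : Measurable f)
    (hfT : ∀ᵐ z ∂μ, f (T z) = f z) (hfin : ∫⁻ z, f z ∂μ ≠ ⊤) : f =ᵐ[μ] 0 := by
  set A : ℤ → Set Z := fun n => {z | ⌊h z⌋ = n}
  have hA : ∀ n, MeasurableSet (A n) := fun n => hh.floor (measurableSet_singleton n)
  have hstep : ∀ n, ∫⁻ z in A (n + 1), f z ∂μ = ∫⁻ z in A n, f z ∂μ := by
    intro n
    have hpre : T ⁻¹' A (n + 1) = A n := by
      ext z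
      simp [A, hhT]
    rw [← hT.setLIntegral_comp_preimage (hA _) hf, hpre]
    exact lintegral_congr_ae (ae_restrict_of_ae hfT)
  have hconst : ∀ n, ∫⁻ z in A n, f z ∂μ = ∫⁻ z in A 0, f z ∂μ := by
    intro n
    induction n using Int.induction_on with
    | zero => rfl
    | succ k ih => rw [hstep, ih]
    | pred k ih => rw [← ih, ← hstep]; simp
  have hU : ⋃ n, A n = univ := by
    ext z
    simp [A]
  have hdisj : Pairwise (Function.onFun Disjoint A) := by
    intro m n hmn
    refine Set.disjoint_left.2 fun z hm hn => hmn ?_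
    exact hm.symm.trans hn
  have hsum : ∫⁻ z, f z ∂μ = ∑' _ : ℤ, ∫⁻ z in A 0, f z ∂μ := by
    rw [← setLIntegral_univ, ← hU, lintegral_iUnion hA hdisj]
    exact tsum_congr hconst
  have h0 : ∫⁻ z in A 0, f z ∂μ = 0 := by
    by_contra hne
    exact hfin (hsum.trans (ENNReal.tsum_const_eq_top_of_ne_zero hne))
  rw [h0, tsum_zero] at hsum
  exact (lintegral_eq_zero_iff hf).1 hsum

theorem ae_add_eq_of_ae_fderiv_eq_zero {E F : Type*} [NormedAddCommGroup E] [NormedSpace ℝ E]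
    [MeasurableSpace E] [BorelSpace E] [SecondCountableTopology E] [NormedAddCommGroup F]
    [NormedSpace ℝ F] [CompleteSpace F] {μ : Measure E} [SFinite μ] {e : E}
    (hμ : ∀ s : ℝ, MeasurePreserving (fun z => z + s • e) μ μ) {u : E → F}
    (hu : Differentiable ℝ u) (h0 : ∀ᵐ z ∂μ, fderiv ℝ u z e = 0) :
    ∀ᵐ z ∂μ, u (z + e) = u z := by
  borelize F
  have hmeas : MeasurableSet {p : ℝ × E | fderiv ℝ u (p.2 + p.1 • e) e = 0} := by
    have hm : Measurable fun p : ℝ × E => p.2 + p.1 • e := by fun_prop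
    exact ((measurable_fderiv_apply_const ℝ u e).comp hm) (measurableSet_singleton 0)
  have hs : ∀ᵐ s : ℝ, ∀ᵐ z ∂μ, fderiv ℝ u (z + s • e) e = 0 :=
    Filter.Eventually.of_forall fun s => (hμ s).quasiMeasurePreserving.ae h0
  rw [Measure.ae_ae_comm hmeas] at hs
  filter_upwards [hs] with z hz
  have hd : ∀ s ∈ uIcc (0 : ℝ) 1,
      HasDerivAt (fun s : ℝ => u (z + s • e)) (fderiv ℝ u (z + s • e) e) s := by
    intro s _
    have h1 : HasDerivAt (fun s : ℝ => z + s • e) e s := by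
      simpa using ((hasDerivAt_id s).smul_const e).const_add z
    exact (hu _).hasFDerivAt.comp_hasDerivAt s h1
  have hi : IntervalIntegrable (fun s : ℝ => fderiv ℝ u (z + s • e) e) volume 0 1 := by
    refine (intervalIntegrable_const (c := (0 : F))).congr_ae ?_
    filter_upwards [ae_restrict_of_ae hz] with s hs using hs.symm
  have hI := intervalIntegral.integral_eq_sub_of_hasDerivAt hd hi
  rw [intervalIntegral.integral_zero_ae (by filter_upwards [hz] with s hs _ using hs)] at hI
  simpa [sub_eq_zero] using hI.symm

theorem InH1.integrable_fderiv_apply {d : ℕ} {u : Edim d × ℝ → ℂ} (hu : InH1 d u)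
    (v : Edim d × ℝ) : IntegrableOn (fun z => ‖fderiv ℝ u z v‖ ^ 2) (strip d) := by
  refine (hu.2.2.2.1.mul_const (‖v‖ ^ 2)).mono'
    ((measurable_fderiv_apply_const ℝ u v).norm.pow_const 2).aestronglyMeasurable ?_
  refine Filter.Eventually.of_forall fun z => ?_
  rw [Real.norm_of_nonneg (by positivity), ← mul_pow]
  gcongr
  exact (fderiv ℝ u z).le_opNorm v

theorem massF_eq_zero_of_ae {d : ℕ} {u : Edim d × ℝ → ℂ}
    (h : ∀ᵐ z ∂(volume.restrict (strip d)), u z = 0) : massF d u = 0 := by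
  refine integral_eq_zero_of_ae ?_
  filter_upwards [h] with z hz
  simp [hz]

theorem qExp_pos {d : ℕ} (hd : 2 ≤ d) : 0 < qExp d := by
  have : (2 : ℝ) ≤ d := by exact_mod_cast hd
  have : 0 < (d : ℝ) - 1 := by linarith
  unfold qExp
  positivity

theorem lpPow_nonneg (d : ℕ) (u : Edim d × ℝ → ℂ) (p : ℝ) : 0 ≤ lpPow d u p :=
  integral_nonneg fun _ => by positivity

theorem InH1.lpPow_pos {d : ℕ} (hd : 2 ≤ d) {u : Edim d × ℝ → ℂ} (hu : InH1 d u)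
    (hm : massF d u ≠ 0) : 0 < lpPow d u (qExp d) := by
  refine (lpPow_nonneg d u _).lt_of_ne' fun h => hm (massF_eq_zero_of_ae ?_)
  have h' := (integral_eq_zero_iff_of_nonneg (fun _ => by positivity) hu.2.2.2.2).1 h
  filter_upwards [h'] with z hz
  simpa [Real.rpow_eq_zero (norm_nonneg (u z)) (qExp_pos hd).ne'] using hz

theorem InH1.gradxSq_pos {d : ℕ} (hd : 2 ≤ d) {u : Edim d × ℝ → ℂ} (hu : InH1 d u)
    (hm : massF d u ≠ 0) : 0 < gradxSq d u := by
  have hnn : 0 ≤ gradxSq d u := integral_nonneg fun _ => by positivity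
  refine hnn.lt_of_ne' fun h => hm (massF_eq_zero_of_ae ?_)
  have h' := (integral_eq_zero_iff_of_nonneg (fun _ => by positivity)
    (integrable_finsetSum _ fun i _ => hu.integrable_fderiv_apply _)).1 h
  let i : Fin d := ⟨0, by lia⟩
  set e : Edim d × ℝ := (EuclideanSpace.single i 1, 0) with he
  have hpres : ∀ s : ℝ, MeasurePreserving (fun z => z + s • e)
      (volume.restrict (strip d)) (volume.restrict (strip d)) := by
    intro s
    have := (measurePreserving_add_right ((volume : Measure (Edim d)).prod (volume : Measure ℝ))
      (s • e)).restrict_preimage (s := strip d) (MeasurableSet.univ.prod measurableSet_Ioc)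
    have hpre : (fun z => z + s • e) ⁻¹' strip d = strip d := by
      ext z
      simp [strip, he]
    rwa [hpre] at this
  have h0 : ∀ᵐ z ∂(volume.restrict (strip d)), fderiv ℝ u z e = 0 := by
    filter_upwards [h'] with z hz
    have := (Finset.sum_eq_zero_iff_of_nonneg (fun _ _ => by positivity)).1 hz i (Finset.mem_univ i)
    simpa using this
  have hshift := ae_add_eq_of_ae_fderiv_eq_zero hpres hu.2.1 h0
  have hcont := hu.2.1.continuous
  have hz := ae_eq_zero_of_lintegral_ne_top_of_shift
    (T := fun z => z + e) (by simpa using hpres 1) (h := fun z => z.1 i) (by fun_prop)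
    (by intro z; simp [he]) (f := fun z => ENNReal.ofReal (‖u z‖ ^ 2)) (by fun_prop)
    (by filter_upwards [hshift] with z hz; rw [hz]) hu.2.2.1.lintegral_lt_top.ne
  filter_upwards [hz] with z hz
  have : ‖u z‖ ^ 2 ≤ 0 := by simpa using hz
  have : ‖u z‖ ^ 2 = 0 := le_antisymm this (by positivity)
  simpa using this

/-- The dilation `(x, y) ↦ (t x, y)`. -/
def dilation (d : ℕ) (t : ℝ) : Edim d × ℝ →L[ℝ] Edim d × ℝ :=
  (t • ContinuousLinearMap.id ℝ (Edim d)).prodMap (ContinuousLinearMap.id ℝ ℝ)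

theorem dilation_apply (d : ℕ) (t : ℝ) (z : Edim d × ℝ) : dilation d t z = (t • z.1, z.2) := rfl

/-- The mass-preserving rescaling `u^t(x, y) = t^{d/2} u(t x, y)`. -/
def rescale (d : ℕ) (t : ℝ) (u : Edim d × ℝ → ℂ) (z : Edim d × ℝ) : ℂ :=
  ((t ^ ((d : ℝ) / 2) : ℝ) : ℂ) * u (dilation d t z)

theorem volume_restrict_strip (d : ℕ) : (volume.restrict (strip d) : Measure (Edim d × ℝ)) =
    volume.prod (volume.restrict (Ioc 0 (2 * π))) := by
  rw [strip, Measure.volume_eq_prod, ← Measure.prod_restrict, Measure.restrict_univ]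

theorem map_dilation {d : ℕ} {t : ℝ} (ht : 0 < t) :
    Measure.map (dilation d t) (volume.restrict (strip d)) =
      ENNReal.ofReal ((t ^ d)⁻¹) • volume.restrict (strip d) := by
  have h : ⇑(dilation d t) = Prod.map (fun x => t • x) id := rfl
  rw [volume_restrict_strip, h, ← Measure.map_prod_map _ _ (by fun_prop) measurable_id,
    Measure.map_id, Measure.map_addHaar_smul _ ht.ne', Measure.prod_smul_left]
  simp [abs_of_pos ht]

theorem measurableEmbedding_dilation {d : ℕ} {t : ℝ} (ht : 0 < t) :
    MeasurableEmbedding (dilation d t) := by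
  refine (dilation d t).continuous.measurableEmbedding fun a b hab => ?_
  simp only [dilation_apply, Prod.mk.injEq, smul_right_inj ht.ne'] at hab
  exact Prod.ext hab.1 hab.2

theorem integral_comp_dilation {d : ℕ} {t : ℝ} (ht : 0 < t) (f : Edim d × ℝ → ℝ) :
    ∫ z in strip d, f (dilation d t z) = (t ^ d)⁻¹ * ∫ z in strip d, f z := by
  rw [← (measurableEmbedding_dilation ht).integral_map, map_dilation ht, integral_smul_measure,
    ENNReal.toReal_ofReal (by positivity), smul_eq_mul]

theorem integrableOn_comp_dilation {d : ℕ} {t : ℝ} (ht : 0 < t) {f : Edim d × ℝ → ℝ}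
    (hf : IntegrableOn f (strip d)) : IntegrableOn (fun z => f (dilation d t z)) (strip d) := by
  refine (measurableEmbedding_dilation ht).integrable_map_iff.1 ?_
  rw [map_dilation ht]
  exact hf.smul_measure ENNReal.ofReal_ne_top

theorem norm_rescale {d : ℕ} {t : ℝ} (ht : 0 < t) (u : Edim d × ℝ → ℂ) (z : Edim d × ℝ) :
    ‖rescale d t u z‖ = t ^ ((d : ℝ) / 2) * ‖u (dilation d t z)‖ := by
  rw [rescale, norm_mul, Complex.norm_real, Real.norm_of_nonneg (by positivity)]

theorem rpow_half_sq {t : ℝ} (ht : 0 < t) (d : ℕ) : (t ^ ((d : ℝ) / 2)) ^ 2 = t ^ d := by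
  rw [← Real.rpow_natCast, ← Real.rpow_mul ht.le, ← Real.rpow_natCast]
  congr 1
  push_cast
  ring

theorem fderiv_rescale {d : ℕ} {t : ℝ} {u : Edim d × ℝ → ℂ}
    (hu : Differentiable ℝ u) (z : Edim d × ℝ) :
    fderiv ℝ (rescale d t u) z =
      ((t ^ ((d : ℝ) / 2) : ℝ) : ℂ) • (fderiv ℝ u (dilation d t z)).comp (dilation d t) :=
  (((hu _).hasFDerivAt.comp z (dilation d t).hasFDerivAt).const_mul _).fderiv

theorem norm_fderiv_rescale_apply {d : ℕ} {t : ℝ} (ht : 0 < t) {u : Edim d × ℝ → ℂ}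
    (hu : Differentiable ℝ u) (z v : Edim d × ℝ) :
    ‖fderiv ℝ (rescale d t u) z v‖ ^ 2 =
      t ^ d * ‖fderiv ℝ u (dilation d t z) (dilation d t v)‖ ^ 2 := by
  rw [fderiv_rescale hu, smul_apply, norm_smul, Complex.norm_real,
    Real.norm_of_nonneg (by positivity), mul_pow, rpow_half_sq ht]
  rfl

theorem massF_rescale {d : ℕ} {t : ℝ} (ht : 0 < t) (u : Edim d × ℝ → ℂ) :
    massF d (rescale d t u) = massF d u := by
  simp only [massF, norm_rescale ht, mul_pow, rpow_half_sq ht]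
  rw [integral_const_mul, integral_comp_dilation ht (fun z => ‖u z‖ ^ 2), ← mul_assoc,
    mul_inv_cancel₀ (by positivity), one_mul]

theorem gradySq_rescale {d : ℕ} {t : ℝ} (ht : 0 < t) {u : Edim d × ℝ → ℂ}
    (hu : Differentiable ℝ u) : gradySq d (rescale d t u) = gradySq d u := by
  have hv : dilation d t (0, 1) = (0, 1) := by simp [dilation_apply]
  simp only [gradySq, norm_fderiv_rescale_apply ht hu, hv]
  rw [integral_const_mul, integral_comp_dilation ht (fun z => ‖fderiv ℝ u z (0, 1)‖ ^ 2),
    ← mul_assoc, mul_inv_cancel₀ (by positivity), one_mul]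

theorem gradxSq_rescale {d : ℕ} {t : ℝ} (ht : 0 < t) {u : Edim d × ℝ → ℂ}
    (hu : Differentiable ℝ u) : gradxSq d (rescale d t u) = t ^ 2 * gradxSq d u := by
  have hv : ∀ i : Fin d, dilation d t (EuclideanSpace.single i 1, 0) =
      t • (EuclideanSpace.single i 1, 0) := fun i => by simp [dilation_apply]
  simp only [gradxSq, norm_fderiv_rescale_apply ht hu, hv, map_smul, norm_smul, mul_pow,
    ← Finset.mul_sum, Real.norm_of_nonneg ht.le]
  rw [integral_const_mul, integral_const_mul, integral_comp_dilation ht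
    (fun z => ∑ i : Fin d, ‖fderiv ℝ u z (EuclideanSpace.single i 1, 0)‖ ^ 2)]
  field_simp

theorem lpPow_rescale {d : ℕ} (hd : 2 ≤ d) {t : ℝ} (ht : 0 < t) (u : Edim d × ℝ → ℂ) :
    lpPow d (rescale d t u) (qExp d) =
      t ^ (2 * (d : ℝ) / ((d : ℝ) - 1)) * lpPow d u (qExp d) := by
  have hd1 : (d : ℝ) - 1 ≠ 0 := by
    have : (2 : ℝ) ≤ d := by exact_mod_cast hd
    linarith
  simp only [lpPow, norm_rescale ht]
  simp_rw [Real.mul_rpow (Real.rpow_nonneg ht.le _) (norm_nonneg _)]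
  rw [integral_const_mul, integral_comp_dilation ht (fun z => ‖u z‖ ^ qExp d), ← mul_assoc,
    ← Real.rpow_mul ht.le, ← Real.rpow_natCast, ← Real.rpow_neg ht.le, ← Real.rpow_add ht]
  congr 2
  rw [qExp]
  field_simp
  ring

theorem InH1.rescale {d : ℕ} {t : ℝ} (ht : 0 < t) {u : Edim d × ℝ → ℂ} (hu : InH1 d u) :
    InH1 d (rescale d t u) := by
  obtain ⟨hper, hdiff, h2, hD, hq⟩ := hu
  have hdiff' : Differentiable ℝ (_root_.rescale d t u) :=
    (hdiff.comp (dilation d t).differentiable).const_mul _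
  refine ⟨fun x y => ?_, hdiff', ?_, ?_, ?_⟩
  · simp only [_root_.rescale, dilation_apply, hper]
  · simp only [norm_rescale ht, mul_pow]
    exact (integrableOn_comp_dilation ht h2).const_mul _
  · refine ((integrableOn_comp_dilation ht hD).const_mul
      (t ^ d * ‖dilation d t‖ ^ 2)).mono'
      ((measurable_fderiv ℝ _).norm.pow_const 2).aestronglyMeasurable ?_
    refine Filter.Eventually.of_forall fun z => ?_
    rw [Real.norm_of_nonneg (by positivity), fderiv_rescale hdiff, norm_smul, Complex.norm_real,
      Real.norm_of_nonneg (by positivity), mul_pow, rpow_half_sq ht, mul_assoc, ← mul_pow,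
      mul_comm ‖dilation d t‖]
    gcongr
    exact ContinuousLinearMap.opNorm_comp_le _ _
  · simp only [norm_rescale ht]
    simp_rw [Real.mul_rpow (Real.rpow_nonneg ht.le _) (norm_nonneg _)]
    exact (integrableOn_comp_dilation ht hq).const_mul _

theorem energyF_eq_IF_add (d : ℕ) (u : Edim d × ℝ → ℂ) :
    energyF d u = IF d u + 1 / 2 * KF d u := by
  have : (d : ℝ) + 1 ≠ 0 := by positivity
  unfold energyF IF KF
  field_simp
  ring

theorem IF_nonneg (d : ℕ) (u : Edim d × ℝ → ℂ) : 0 ≤ IF d u := by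
  have := lpPow_nonneg d u (qExp d)
  have : 0 ≤ gradySq d u := integral_nonneg fun _ => by positivity
  unfold IF
  positivity

/-- If `K(u) ≤ 0`, some rescaling `u^t` with `t ∈ (0, 1]` satisfies `K(u^t) = 0`. -/
theorem InH1.exists_KF_rescale_eq_zero {d : ℕ} (hd : 2 ≤ d) {u : Edim d × ℝ → ℂ}
    (hu : InH1 d u) (hm : massF d u ≠ 0) (hK : KF d u ≤ 0) :
    ∃ t, 0 < t ∧ t ≤ 1 ∧ KF d (_root_.rescale d t u) = 0 := by
  have hd2 : (2 : ℝ) ≤ d := by exact_mod_cast hd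
  have hd1 : 0 < (d : ℝ) - 1 := by linarith
  have hG := hu.gradxSq_pos hd hm
  have hP := hu.lpPow_pos hd hm
  unfold KF at hK
  set G := gradxSq d u with hGdef
  set P := lpPow d u (qExp d) with hPdef
  set r := G / ((d : ℝ) / (d + 1) * P) with hr
  have hden : 0 < (d : ℝ) / (d + 1) * P := by positivity
  have hr0 : 0 < r := by positivity
  have hr1 : r ≤ 1 := (div_le_one hden).2 (by linarith)
  have ht : 0 < r ^ (((d : ℝ) - 1) / 2) := Real.rpow_pos_of_pos hr0 _
  refine ⟨r ^ (((d : ℝ) - 1) / 2), ht, Real.rpow_le_one hr0.le hr1 (by positivity), ?_⟩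
  have hpow : (r ^ (((d : ℝ) - 1) / 2)) ^ (2 * (d : ℝ) / ((d : ℝ) - 1)) =
      (r ^ (((d : ℝ) - 1) / 2)) ^ 2 * r := by
    rw [← Real.rpow_natCast, ← Real.rpow_mul hr0.le, ← Real.rpow_mul hr0.le,
      ← Real.rpow_add_one hr0.ne']
    congr 1
    push_cast
    field_simp
    ring
  have hrG : (d : ℝ) / (d + 1) * P * r = G := mul_div_cancel₀ _ hden.ne'
  rw [KF, gradxSq_rescale ht hu.2.1, lpPow_rescale hd ht, hpow, ← hGdef, ← hPdef]
  linear_combination -(r ^ (((d : ℝ) - 1) / 2)) ^ 2 * hrG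

theorem InH1.IF_rescale_le {d : ℕ} (hd : 2 ≤ d) {u : Edim d × ℝ → ℂ} (hu : InH1 d u) {t : ℝ}
    (ht : 0 < t) (ht1 : t ≤ 1) : IF d (_root_.rescale d t u) ≤ IF d u := by
  have hd2 : (2 : ℝ) ≤ d := by exact_mod_cast hd
  have hd1 : 0 < (d : ℝ) - 1 := by linarith
  rw [IF, IF, gradySq_rescale ht hu.2.1, lpPow_rescale hd ht]
  gcongr
  exact mul_le_of_le_one_left (lpPow_nonneg d u _) (Real.rpow_le_one ht.le ht1 (by positivity))

/-- Le Coz characterization: `m_c = m̃_c` for every mass `c > 0`. -/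
theorem mGround_eq_mTilde (d : ℕ) (hd : 2 ≤ d) (c : ℝ) (hc : 0 < c) :
    mGround d c = mTilde d c := by
  let S := {e | ∃ u, InH1 d u ∧ massF d u = c ∧ KF d u = 0 ∧ energyF d u = e}
  let S' := {e | ∃ u, InH1 d u ∧ massF d u = c ∧ KF d u ≤ 0 ∧ IF d u = e}
  change sInf S = sInf S'
  have hsub : S ⊆ S' := by
    rintro e ⟨u, hu, hm, hK, rfl⟩
    exact ⟨u, hu, hm, hK.le, by rw [energyF_eq_IF_add, hK]; ring⟩
  have hbdd : BddBelow S' := by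
    refine ⟨0, ?_⟩
    rintro e ⟨u, -, -, -, rfl⟩
    exact IF_nonneg d u
  have hdom : ∀ e ∈ S', ∃ e' ∈ S, e' ≤ e := by
    rintro e ⟨u, hu, hm, hK, rfl⟩
    obtain ⟨t, ht, ht1, hKt⟩ := hu.exists_KF_rescale_eq_zero hd (hm ▸ hc.ne') hK
    refine ⟨_, ⟨rescale d t u, hu.rescale ht, (massF_rescale ht u).trans hm, hKt, rfl⟩, ?_⟩
    rw [energyF_eq_IF_add, hKt, mul_zero, add_zero]
    exact hu.IF_rescale_le hd ht ht1
  rcases S'.eq_empty_or_nonempty with hemp | hne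
  · rw [hemp, subset_empty_iff.1 (hsub.trans hemp.subset)]
  · obtain ⟨e, he⟩ := hne
    obtain ⟨e', he', -⟩ := hdom e he
    refine le_antisymm (le_csInf ⟨e, he⟩ fun a ha => ?_) (csInf_le_csInf hbdd ⟨e', he'⟩ hsub)
    obtain ⟨b, hb, hba⟩ := hdom a ha
    exact (csInf_le (hbdd.mono hsub) hb).trans hba

end
end

section
/- For every u ∈ H^1(R^2 × T) (i.e. d = 2 here, but the statement for general d ≥ 2 reads): there exists a constant C > 0 depending only on d such that ‖u‖_{L^{2(d+1)/(d−1)}(R^d×T)}^{2(d+1)/(d−1)} ≤ C ‖∇_x u‖_{L^2}^{2d/(d−1)} (‖u‖_{L^2}^{2/(d−1)} + ‖∂_y u‖_{L^2}^{2/(d−1)}). -/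
open MeasureTheory Real Set

open scoped ENNReal

theorem enorm_rpow_le_add_lintegral_deriv {w : ℝ → ℂ} (hw : Differentiable ℝ w) {s : ℝ}
    (hs : 1 < s) (a b : ℝ) :
    ‖w b‖ₑ ^ s ≤ ‖w a‖ₑ ^ s +
      ∫⁻ t in uIoc a b, ENNReal.ofReal s * ‖w t‖ₑ ^ (s - 1) * ‖deriv w t‖ₑ := by
  set J := ∫⁻ t in uIoc a b, ENNReal.ofReal s * ‖w t‖ₑ ^ (s - 1) * ‖deriv w t‖ₑ
  have hs0 : 0 ≤ s := by linarith
  by_cases hJ : J = ∞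
  · simp [hJ]
  have hg : Differentiable ℝ fun t => ‖w t‖ ^ s := hw.norm_rpow hs
  have hbound (t : ℝ) : ‖deriv (fun t => ‖w t‖ ^ s) t‖ₑ ≤
      ENNReal.ofReal s * ‖w t‖ₑ ^ (s - 1) * ‖deriv w t‖ₑ := by
    have h := enorm_fderiv_norm_rpow_le hw (x := t) (p := s.toNNReal)
      (by simpa using hs)
    rw [Real.coe_toNNReal _ hs0] at h
    simpa only [← norm_deriv_eq_norm_fderiv, ← ofReal_norm, ENNReal.ofReal] using h
  have hle : ∫⁻ t in uIoc a b, ‖deriv (fun t => ‖w t‖ ^ s) t‖ₑ ≤ J := by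
    exact lintegral_mono hbound
  have hint : IntervalIntegrable (deriv fun t => ‖w t‖ ^ s) volume a b := by
    rw [intervalIntegrable_iff]
    exact ⟨(measurable_deriv _).aestronglyMeasurable, hle.trans_lt (lt_top_iff_ne_top.2 hJ)⟩
  have hftc := intervalIntegral.integral_eq_sub_of_hasDerivAt
    (fun t _ => (hg t).hasDerivAt) hint
  have hdiff : ‖‖w b‖ ^ s - ‖w a‖ ^ s‖ₑ ≤ J := by
    rw [← hftc, ← ofReal_norm, intervalIntegral.norm_intervalIntegral_eq, ofReal_norm]
    exact (enorm_integral_le_lintegral_enorm _).trans hle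
  have hr (t : ℝ) : ‖w t‖ₑ ^ s = ‖‖w t‖ ^ s‖ₑ := by
    rw [Real.enorm_rpow_of_nonneg (norm_nonneg _) hs0, enorm_norm]
  rw [hr, hr]
  calc ‖‖w b‖ ^ s‖ₑ = ‖‖w a‖ ^ s + (‖w b‖ ^ s - ‖w a‖ ^ s)‖ₑ := by rw [add_sub_cancel]
    _ ≤ _ := (enorm_add_le _ _).trans (by gcongr)

theorem enorm_rpow_le_lintegral_deriv {w : ℝ → ℂ} (hw : Differentiable ℝ w) {s q : ℝ}
    (hs : 1 < s) (hq : 0 < q) (hfin : ∫⁻ t, ‖w t‖ₑ ^ q ≠ ∞) (x : ℝ) :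
    ‖w x‖ₑ ^ s ≤ ∫⁻ t, ENNReal.ofReal s * ‖w t‖ₑ ^ (s - 1) * ‖deriv w t‖ₑ := by
  have hs0 : 0 < s := by linarith
  by_contra! h
  obtain ⟨c, hJc, hcx⟩ := exists_between h
  have hne := hJc.ne_top
  set J := ∫⁻ t, ENNReal.ofReal s * ‖w t‖ₑ ^ (s - 1) * ‖deriv w t‖ₑ
  have hlow (t : ℝ) : c - J ≤ ‖w t‖ₑ ^ s := by
    rw [tsub_le_iff_right]
    refine hcx.le.trans ((enorm_rpow_le_add_lintegral_deriv hw hs t x).trans ?_)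
    gcongr
    exact setLIntegral_le_lintegral _ _
  have hpos : 0 < (c - J) ^ (q / s) :=
    ENNReal.rpow_pos (tsub_pos_of_lt hJc) (ne_top_of_le_ne_top (hcx.ne_top) tsub_le_self)
  refine hfin (top_le_iff.1 ?_)
  calc ∞ = ∫⁻ _ : ℝ, (c - J) ^ (q / s) := by
        simp [ENNReal.mul_top, hpos.ne']
    _ ≤ ∫⁻ t, ‖w t‖ₑ ^ q := by
        refine lintegral_mono fun t => ?_
        calc (c - J) ^ (q / s) ≤ (‖w t‖ₑ ^ s) ^ (q / s) := by gcongr; exact hlow t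
          _ = ‖w t‖ₑ ^ q := by rw [← ENNReal.rpow_mul, mul_div_cancel₀ _ hs0.ne']

theorem enorm_rpow_le_lintegral_Ioc {w : ℝ → ℂ} (hw : Differentiable ℝ w) {s L : ℝ}
    (hs : 1 < s) (hL : 0 < L) {x : ℝ} (hx : x ∈ Ioc 0 L) :
    ‖w x‖ₑ ^ s ≤ ∫⁻ t in Ioc 0 L, (ENNReal.ofReal L⁻¹ * ‖w t‖ₑ ^ (s - 1) * ‖w t‖ₑ +
      ENNReal.ofReal s * ‖w t‖ₑ ^ (s - 1) * ‖deriv w t‖ₑ) := by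
  have hmw : Measurable w := hw.continuous.measurable
  set J := ∫⁻ t in Ioc 0 L, ENNReal.ofReal s * ‖w t‖ₑ ^ (s - 1) * ‖deriv w t‖ₑ with hJ
  have hpt : ∀ t ∈ Ioc 0 L, ‖w x‖ₑ ^ s ≤ ‖w t‖ₑ ^ s + J := by
    intro t ht
    refine (enorm_rpow_le_add_lintegral_deriv hw hs t x).trans ?_
    gcongr
    refine lintegral_mono_set ?_
    exact Ioc_subset_Ioc (le_min ht.1.le hx.1.le) (max_le ht.2 hx.2)
  have hLne : ENNReal.ofReal L ≠ 0 := by simpa using hL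
  have hint : ENNReal.ofReal L * ‖w x‖ₑ ^ s ≤
      (∫⁻ t in Ioc 0 L, ‖w t‖ₑ ^ s) + ENNReal.ofReal L * J := by
    calc ENNReal.ofReal L * ‖w x‖ₑ ^ s = ∫⁻ _ in Ioc 0 L, ‖w x‖ₑ ^ s := by simp [mul_comm]
      _ ≤ ∫⁻ t in Ioc 0 L, (‖w t‖ₑ ^ s + J) := setLIntegral_mono' measurableSet_Ioc hpt
      _ = _ := by rw [lintegral_add_right _ measurable_const]; simp [mul_comm]
  have hpow (t : ℝ) : ENNReal.ofReal L⁻¹ * ‖w t‖ₑ ^ (s - 1) * ‖w t‖ₑ =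
      ENNReal.ofReal L⁻¹ * ‖w t‖ₑ ^ s := by
    rw [mul_assoc]
    nth_rw 2 [← ENNReal.rpow_one ‖w t‖ₑ]
    rw [← ENNReal.rpow_add_of_nonneg _ _ (by linarith) zero_le_one, sub_add_cancel]
  simp_rw [hpow]
  rw [lintegral_add_left (by fun_prop), lintegral_const_mul _ (by fun_prop), ← hJ,
    ENNReal.ofReal_inv_of_pos hL]
  calc ‖w x‖ₑ ^ s = (ENNReal.ofReal L)⁻¹ * (ENNReal.ofReal L * ‖w x‖ₑ ^ s) := by
        rw [← mul_assoc, ENNReal.inv_mul_cancel hLne ENNReal.ofReal_ne_top, one_mul]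
    _ ≤ (ENNReal.ofReal L)⁻¹ * ((∫⁻ t in Ioc 0 L, ‖w t‖ₑ ^ s) + ENNReal.ofReal L * J) := by gcongr
    _ = _ := by
        rw [mul_add, ← mul_assoc _ _ J, ENNReal.inv_mul_cancel hLne ENNReal.ofReal_ne_top, one_mul]

/-- A Loomis–Whitney type inequality: the grid-lines lemma with a different function for every
direction. -/
theorem lintegral_rpow_le_prod_lintegral {ι : Type*} [Fintype ι] [DecidableEq ι]
    (μ : ι → Measure ℝ) [∀ i, SigmaFinite (μ i)] {p : ℝ}
    (hp : Real.HolderConjugate (Fintype.card ι) p) {φ : (ι → ℝ) → ℝ≥0∞} {f : ι → (ι → ℝ) → ℝ≥0∞}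
    (hf : ∀ i, Measurable (f i))
    (hφ : ∀ i, ∀ᵐ x ∂Measure.pi μ, φ x ≤ ∫⁻ t, f i (Function.update x i t) ∂μ i)
    (h0 : ∀ i, ∫⁻ x, f i x ∂Measure.pi μ ≠ 0) (htop : ∀ i, ∫⁻ x, f i x ∂Measure.pi μ ≠ ∞) :
    ∫⁻ x, φ x ^ p ∂Measure.pi μ ≤ (Fintype.card ι : ℝ≥0∞) ^ p *
      ∏ i, (∫⁻ x, f i x ∂Measure.pi μ) ^ (1 / ((Fintype.card ι : ℝ) - 1)) := by
  set I : ι → ℝ≥0∞ := fun i => ∫⁻ x, f i x ∂Measure.pi μ with hI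
  set r : ℝ := 1 / ((Fintype.card ι : ℝ) - 1) with hr
  have hcard : (1 : ℝ) < Fintype.card ι := hp.lt
  have hr0 : 0 ≤ r := by rw [hr]; exact one_div_nonneg.2 (by linarith)
  have hpr : p = r * Fintype.card ι := by
    rw [hr, hp.conjugate_eq]; ring
  set g : (ι → ℝ) → ℝ≥0∞ := fun x => ∑ i, (I i)⁻¹ * f i x with hg
  have hgm : Measurable g := by fun_prop
  have hgI : ∫⁻ x, g x ∂Measure.pi μ = Fintype.card ι := by
    rw [hg, lintegral_finsetSum _ (by fun_prop)]
    simp_rw [lintegral_const_mul _ (hf _)]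
    rw [Finset.sum_congr rfl fun i _ => ENNReal.inv_mul_cancel (h0 i) (htop i)]
    simp
  have hfg (i : ι) (x : ι → ℝ) : f i x ≤ I i * g x := by
    calc f i x = I i * ((I i)⁻¹ * f i x) := by
          rw [← mul_assoc, ENNReal.mul_inv_cancel (h0 i) (htop i), one_mul]
      _ ≤ I i * g x := by
          gcongr
          exact Finset.single_le_sum (f := fun i => (I i)⁻¹ * f i x) (fun _ _ => zero_le)
            (Finset.mem_univ i)
  have hline (i : ι) (x : ι → ℝ) : ∫⁻ t, f i (Function.update x i t) ∂μ i ≤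
      I i * ∫⁻ t, g (Function.update x i t) ∂μ i := by
    rw [← lintegral_const_mul _ (by fun_prop)]
    exact lintegral_mono fun t => hfg i _
  calc ∫⁻ x, φ x ^ p ∂Measure.pi μ
      ≤ ∫⁻ x, (∏ i, I i ^ r) * ∏ i, (∫⁻ t, g (Function.update x i t) ∂μ i) ^ r ∂Measure.pi μ := by
        refine lintegral_mono_ae ?_
        filter_upwards [Filter.eventually_all.2 hφ] with x hx
        calc φ x ^ p = ∏ _i : ι, φ x ^ r := by
              rw [Finset.prod_const, hpr, ENNReal.rpow_mul, ENNReal.rpow_natCast,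
                Finset.card_univ]
          _ ≤ ∏ i, (I i * ∫⁻ t, g (Function.update x i t) ∂μ i) ^ r := by
              gcongr with i
              exact (hx i).trans (hline i x)
          _ = _ := by
              simp_rw [ENNReal.mul_rpow_of_nonneg _ _ hr0]
              rw [Finset.prod_mul_distrib]
    _ = (∏ i, I i ^ r) *
          ∫⁻ x, ∏ i, (∫⁻ t, g (Function.update x i t) ∂μ i) ^ r ∂Measure.pi μ := by
        refine lintegral_const_mul' _ _ ?_
        exact ENNReal.prod_ne_top fun i _ => ENNReal.rpow_ne_top_of_nonneg hr0 (htop i)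
    _ ≤ (∏ i, I i ^ r) * (∫⁻ x, g x ∂Measure.pi μ) ^ p := by
        gcongr
        exact lintegral_prod_lintegral_pow_le μ hp hgm
    _ = _ := by rw [hgI, mul_comm]

/-- The coordinates `(y, x₁, …, x_d) ↦ (x, y)` of `ℝ^d × ℝ`, as a linear map. -/
noncomputable def stripCoord (d : ℕ) : (Fin (d + 1) → ℝ) →L[ℝ] Edim d × ℝ :=
  ((PiLp.continuousLinearEquiv 2 ℝ fun _ : Fin d => ℝ).symm.toContinuousLinearMap.comp
    (ContinuousLinearMap.pi fun j => ContinuousLinearMap.proj j.succ)).prod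
    (ContinuousLinearMap.proj 0)

/-- The factors of the measure on `ℝ^d × (0, 2π]` in the coordinates `stripCoord`. -/
noncomputable def stripMeasure (d : ℕ) : Fin (d + 1) → Measure ℝ :=
  Fin.cons (volume.restrict (Ioc 0 (2 * π))) fun _ => volume

instance (d : ℕ) (i : Fin (d + 1)) : SigmaFinite (stripMeasure d i) := by
  refine Fin.cases ?_ (fun j => ?_) i
  · exact inferInstanceAs (SigmaFinite (volume.restrict (Ioc 0 (2 * π))))
  · exact inferInstanceAs (SigmaFinite (volume : Measure ℝ))

theorem stripCoord_single_zero (d : ℕ) : stripCoord d (Pi.single 0 1) = (0, 1) := by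
  ext <;> simp [stripCoord]

theorem stripCoord_single_succ {d : ℕ} (j : Fin d) :
    stripCoord d (Pi.single j.succ 1) = (EuclideanSpace.single j 1, 0) := by
  ext k
  · simp [stripCoord, Pi.single_apply]
  · simp [stripCoord]

theorem measurePreserving_stripCoord (d : ℕ) :
    MeasurePreserving (stripCoord d) (Measure.pi (stripMeasure d))
      (volume.restrict (strip d)) := by
  have hvol : (volume : Measure (Edim d × ℝ)).restrict (strip d) =
      (volume : Measure (Edim d)).prod (volume.restrict (Ioc 0 (2 * π))) := by
    rw [strip, Measure.volume_eq_prod, ← Measure.prod_restrict, Measure.restrict_univ]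
  rw [hvol]
  have h := measurePreserving_piFinSuccAbove (stripMeasure d) 0
  have hswap := Measure.measurePreserving_swap
    (μ := stripMeasure d 0) (ν := Measure.pi fun j : Fin d => stripMeasure d (Fin.succAbove 0 j))
  have hlp : MeasurePreserving (WithLp.toLp 2 : (Fin d → ℝ) → Edim d)
      (Measure.pi fun j : Fin d => stripMeasure d (Fin.succAbove 0 j)) volume :=
    PiLp.volume_preserving_toLp (Fin d)
  have hid : MeasurePreserving (id : ℝ → ℝ) (stripMeasure d 0)
      (volume.restrict (Ioc 0 (2 * π))) := MeasurePreserving.id _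
  exact (hlp.prod hid).comp (hswap.comp h)

theorem lintegral_rpow_mul_le_sqrt_mul_sqrt {α : Type*} [MeasurableSpace α] {μ : Measure α}
    {f h : α → ℝ≥0∞} (hf : Measurable f) (hh : Measurable h) (r : ℝ) :
    ∫⁻ z, f z ^ r * h z ∂μ ≤
      (∫⁻ z, f z ^ (2 * r) ∂μ) ^ (1 / 2 : ℝ) * (∫⁻ z, h z ^ (2 : ℝ) ∂μ) ^ (1 / 2 : ℝ) := by
  have H := ENNReal.lintegral_mul_le_Lp_mul_Lq μ Real.HolderConjugate.two_two
    (hf.pow_const r).aemeasurable hh.aemeasurable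
  simpa only [Pi.mul_apply, ← ENNReal.rpow_mul, mul_comm r] using H

/-- The function whose integral along the lines in direction `i` controls `‖u‖ ^ s`. The term with
`δ` makes that integral infinite on the lines where `‖u‖ ^ q` is not integrable. -/
noncomputable def lineMajorant (d : ℕ) (u : Edim d × ℝ → ℂ) (s q δ : ℝ)
    (i : Fin (d + 1)) (z : Edim d × ℝ) :
    ℝ≥0∞ :=
  ENNReal.ofReal (if i = 0 then (2 * π)⁻¹ else 0) * (‖u z‖ₑ ^ (s - 1) * ‖u z‖ₑ) +
    ENNReal.ofReal s * (‖u z‖ₑ ^ (s - 1) * ‖fderiv ℝ u z (stripCoord d (Pi.single i 1))‖ₑ) +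
    ENNReal.ofReal δ * ‖u z‖ₑ ^ q

theorem measurable_lineMajorant {d : ℕ} {u : Edim d × ℝ → ℂ} (hu : Differentiable ℝ u)
    (s q δ : ℝ) (i : Fin (d + 1)) : Measurable (lineMajorant d u s q δ i) := by
  have hm : Measurable u := hu.continuous.measurable
  have := measurable_fderiv_apply_const ℝ u (stripCoord d (Pi.single i 1))
  unfold lineMajorant
  fun_prop

theorem enorm_rpow_le_lintegral_lineMajorant {d : ℕ} {u : Edim d × ℝ → ℂ}
    (hu : Differentiable ℝ u) {s q δ : ℝ} (hs : 1 < s) (hq : 0 < q) (hδ : 0 < δ)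
    (i : Fin (d + 1)) :
    ∀ᵐ x ∂Measure.pi (stripMeasure d), ‖u (stripCoord d x)‖ₑ ^ s ≤
      ∫⁻ t, lineMajorant d u s q δ i (stripCoord d (Function.update x i t)) ∂stripMeasure d i := by
  have hderiv (x : Fin (d + 1) → ℝ) (t : ℝ) :
      HasDerivAt (fun t => u (stripCoord d (Function.update x i t)))
        (fderiv ℝ u (stripCoord d (Function.update x i t)) (stripCoord d (Pi.single i 1))) t :=
    (hu _).hasFDerivAt.comp_hasDerivAt t
      ((stripCoord d).hasFDerivAt.comp_hasDerivAt t (hasDerivAt_update x i t))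
  have hdiff (x : Fin (d + 1) → ℝ) :
      Differentiable ℝ fun t => u (stripCoord d (Function.update x i t)) :=
    fun t => (hderiv x t).differentiableAt
  have hmeas (x : Fin (d + 1) → ℝ) :
      Measurable fun t => u (stripCoord d (Function.update x i t)) :=
    (hdiff x).continuous.measurable
  induction i using Fin.cases with
  | zero =>
    have hmem : ∀ᵐ x ∂Measure.pi (stripMeasure d), x 0 ∈ Ioc 0 (2 * π) :=
      Measure.tendsto_eval_ae_ae.eventually (ae_restrict_mem measurableSet_Ioc)
    filter_upwards [hmem] with x hx
    have h := enorm_rpow_le_lintegral_Ioc (hdiff x) hs two_pi_pos hx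
    simp only [Function.update_eq_self, (hderiv x _).deriv] at h
    refine h.trans (lintegral_mono fun t => ?_)
    simp only [lineMajorant, if_true, mul_assoc]
    exact le_self_add
  | succ j =>
    refine Filter.Eventually.of_forall fun x => ?_
    change _ ≤ ∫⁻ t : ℝ, _
    by_cases hfin : ∫⁻ t, ‖u (stripCoord d (Function.update x j.succ t))‖ₑ ^ q = ∞
    · refine le_top.trans ?_
      calc ∞ = ∫⁻ t, ENNReal.ofReal δ * ‖u (stripCoord d (Function.update x j.succ t))‖ₑ ^ q := by
            rw [lintegral_const_mul _ ((hmeas x).enorm.pow_const q), hfin,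
              ENNReal.mul_top (by simpa using hδ)]
        _ ≤ _ := lintegral_mono fun t => le_add_self
    · have h := enorm_rpow_le_lintegral_deriv (hdiff x) hs hq hfin (x j.succ)
      simp only [Function.update_eq_self, (hderiv x _).deriv] at h
      refine h.trans (lintegral_mono fun t => ?_)
      simp only [lineMajorant, mul_assoc]
      exact le_add_right le_add_self

theorem lintegral_lineMajorant_le {d : ℕ} {u : Edim d × ℝ → ℂ} (hu : Differentiable ℝ u)
    {s q δ a m b : ℝ} (hs : 0 ≤ s) (hq : q = 2 * (s - 1)) (hδ : 0 ≤ δ) (ha : 0 ≤ a)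
    (hm : 0 ≤ m) (hb : 0 ≤ b) (i : Fin (d + 1))
    (hua : ∫⁻ z in strip d, ‖u z‖ₑ ^ q ≤ ENNReal.ofReal a)
    (hum : ∫⁻ z in strip d, ‖u z‖ₑ ^ (2 : ℝ) ≤ ENNReal.ofReal m)
    (hub : ∫⁻ z in strip d, ‖fderiv ℝ u z (stripCoord d (Pi.single i 1))‖ₑ ^ (2 : ℝ) ≤
      ENNReal.ofReal b) :
    ∫⁻ z in strip d, lineMajorant d u s q δ i z ≤
      ENNReal.ofReal ((if i = 0 then (2 * π)⁻¹ else 0) * (√a * √m) + s * (√a * √b) + δ * a) := by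
  have hmu : Measurable u := hu.continuous.measurable
  have hmd := measurable_fderiv_apply_const ℝ u (stripCoord d (Pi.single i 1))
  have hsqrt {x : ℝ} (hx : 0 ≤ x) : ENNReal.ofReal x ^ (1 / 2 : ℝ) = ENNReal.ofReal √x := by
    rw [ENNReal.ofReal_rpow_of_nonneg hx (by norm_num), Real.sqrt_eq_rpow]
  have hcs {h : Edim d × ℝ → ℝ≥0∞} {c : ℝ} (hh : Measurable h) (hc : 0 ≤ c)
      (hle : ∫⁻ z in strip d, h z ^ (2 : ℝ) ≤ ENNReal.ofReal c) :
      ∫⁻ z in strip d, ‖u z‖ₑ ^ (s - 1) * h z ≤ ENNReal.ofReal (√a * √c) := by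
    refine (lintegral_rpow_mul_le_sqrt_mul_sqrt hmu.enorm hh (s - 1)).trans ?_
    rw [← hq, ENNReal.ofReal_mul (Real.sqrt_nonneg a), ← hsqrt ha, ← hsqrt hc]
    gcongr
  have hif : 0 ≤ (if i = 0 then (2 * π)⁻¹ else 0 : ℝ) := by split_ifs <;> positivity
  unfold lineMajorant
  rw [lintegral_add_left (by fun_prop), lintegral_add_left (by fun_prop),
    lintegral_const_mul _ (by fun_prop), lintegral_const_mul _ (by fun_prop),
    lintegral_const_mul _ (by fun_prop), ENNReal.ofReal_add (by positivity) (by positivity),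
    ENNReal.ofReal_add (by positivity) (by positivity), ENNReal.ofReal_mul hif,
    ENNReal.ofReal_mul hs, ENNReal.ofReal_mul hδ]
  gcongr
  · exact hcs hmu.enorm hm hum
  · exact hcs hmd.enorm hb hub

theorem lintegral_enorm_rpow_eq_ofReal {α E : Type*} [MeasurableSpace α] [NormedAddCommGroup E]
    {μ : Measure α} {f : α → E} {r : ℝ} (hr : 0 ≤ r) (hf : Integrable (fun z => ‖f z‖ ^ r) μ) :
    ∫⁻ z, ‖f z‖ₑ ^ r ∂μ = ENNReal.ofReal (∫ z, ‖f z‖ ^ r ∂μ) := by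
  rw [ofReal_integral_eq_lintegral_ofReal hf (ae_of_all _ fun z => by positivity)]
  simp_rw [← ENNReal.ofReal_rpow_of_nonneg (norm_nonneg _) hr, ofReal_norm]

/-- Solving `a ≤ K √a √b (√a m)^{1/d}` for `a`. -/
theorem le_of_le_mul_sqrt_mul_rpow {D K a b m : ℝ} (hD : 1 < D) (hK : 0 ≤ K) (ha : 0 ≤ a)
    (hb : 0 ≤ b) (hm : 0 ≤ m) (h : a ≤ K * (√a * √b) * (√a * m) ^ (1 / D)) :
    a ≤ K ^ (2 * D / (D - 1)) * b ^ (D / (D - 1)) * m ^ (2 / (D - 1)) := by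
  rcases ha.eq_or_lt with rfl | ha'
  · positivity
  have hD0 : 0 < D := by linarith
  have hD1 : 0 < D - 1 := by linarith
  have hsplit : √a * √a ^ (1 / D) = a ^ ((D + 1) / (2 * D)) := by
    rw [Real.sqrt_eq_rpow, ← Real.rpow_mul ha, ← Real.rpow_add ha']
    congr 1; field_simp
  have ha2 : a = a ^ ((D + 1) / (2 * D)) * a ^ ((D - 1) / (2 * D)) := by
    rw [← Real.rpow_add ha', show (D + 1) / (2 * D) + (D - 1) / (2 * D) = 1 by field_simp; ring,
      Real.rpow_one]
  have h2 : a ^ ((D - 1) / (2 * D)) ≤ K * √b * m ^ (1 / D) := by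
    refine le_of_mul_le_mul_left ?_ (Real.rpow_pos_of_pos ha' ((D + 1) / (2 * D)))
    rw [← ha2, ← hsplit]
    refine h.trans_eq ?_
    rw [Real.mul_rpow (Real.sqrt_nonneg a) hm]
    ring
  calc a = (a ^ ((D - 1) / (2 * D))) ^ (2 * D / (D - 1)) := by
        rw [← Real.rpow_mul ha, show (D - 1) / (2 * D) * (2 * D / (D - 1)) = 1 by field_simp,
          Real.rpow_one]
    _ ≤ (K * √b * m ^ (1 / D)) ^ (2 * D / (D - 1)) := by gcongr
    _ = _ := by
        rw [Real.mul_rpow (by positivity) (by positivity), Real.mul_rpow hK (by positivity),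
          Real.sqrt_eq_rpow, ← Real.rpow_mul hb, ← Real.rpow_mul hm,
          show 1 / 2 * (2 * D / (D - 1)) = D / (D - 1) by ring,
          show 1 / D * (2 * D / (D - 1)) = 2 / (D - 1) by field_simp]

theorem sqrt_add_sqrt_rpow_le {x y r : ℝ} (hx : 0 ≤ x) (hy : 0 ≤ y) (hr : 0 ≤ r) :
    (√x + √y) ^ (2 * r) ≤ 2 ^ (2 * r) * (x ^ r + y ^ r) := by
  have hpow {t : ℝ} (ht : 0 ≤ t) : √t ^ (2 * r) = t ^ r := by
    rw [Real.sqrt_eq_rpow, ← Real.rpow_mul ht]; congr 1; ring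
  wlog hxy : x ≤ y generalizing x y
  · rw [add_comm √x, add_comm (x ^ r)]
    exact this hy hx (le_of_not_ge hxy)
  calc (√x + √y) ^ (2 * r) ≤ (2 * √y) ^ (2 * r) := by
        gcongr
        linarith [Real.sqrt_le_sqrt hxy]
    _ = 2 ^ (2 * r) * y ^ r := by
        rw [Real.mul_rpow (by norm_num) (Real.sqrt_nonneg y), hpow hy]
    _ ≤ _ := by gcongr; exact le_add_of_nonneg_left (by positivity)

theorem le_prod_directional {d : ℕ} (hd : 2 ≤ d) {u : Edim d × ℝ → ℂ} (hu : Differentiable ℝ u)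
    {s q δ a m : ℝ} {b : Fin (d + 1) → ℝ} (hs : s = 2 * d / ((d : ℝ) - 1))
    (hq : q = 2 * (s - 1)) (hδ : 0 < δ) (ha : 0 < a) (hm : 0 ≤ m) (hb : ∀ i, 0 ≤ b i)
    (hua : ∫⁻ z in strip d, ‖u z‖ₑ ^ q = ENNReal.ofReal a)
    (hum : ∫⁻ z in strip d, ‖u z‖ₑ ^ (2 : ℝ) ≤ ENNReal.ofReal m)
    (hub : ∀ i, ∫⁻ z in strip d, ‖fderiv ℝ u z (stripCoord d (Pi.single i 1))‖ₑ ^ (2 : ℝ) ≤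
      ENNReal.ofReal (b i)) :
    a ≤ ((d : ℝ) + 1) ^ (((d : ℝ) + 1) / d) * ∏ i : Fin (d + 1),
      ((if i = 0 then (2 * π)⁻¹ else 0) * (√a * √m) + s * (√a * √(b i)) + δ * a) ^
        (1 / (d : ℝ)) := by
  have hD : (2 : ℝ) ≤ d := by exact_mod_cast hd
  have hD1 : (0 : ℝ) < (d : ℝ) - 1 := by linarith
  have hs1 : 1 < s := by rw [hs, lt_div_iff₀ hD1]; linarith
  have hq0 : 0 < q := by rw [hq]; linarith
  set p : ℝ := ((d : ℝ) + 1) / d with hp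
  have hconj : Real.HolderConjugate (Fintype.card (Fin (d + 1))) p := by
    rw [Real.holderConjugate_iff, hp, Fintype.card_fin]
    push_cast
    exact ⟨by linarith, by field_simp; ring⟩
  have hsp : s * p = q := by rw [hq, hs, hp]; field_simp; ring
  have hmp := measurePreserving_stripCoord d
  have hmu : Measurable u := hu.continuous.measurable
  have hint (i : Fin (d + 1)) :
      ∫⁻ x, lineMajorant d u s q δ i (stripCoord d x) ∂Measure.pi (stripMeasure d) =
        ∫⁻ z in strip d, lineMajorant d u s q δ i z :=
    hmp.lintegral_comp (measurable_lineMajorant hu s q δ i)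
  have hle (i : Fin (d + 1)) := lintegral_lineMajorant_le hu (by linarith : 0 ≤ s) hq hδ.le ha.le
    hm (hb i) i hua.le hum (hub i)
  have hne (i : Fin (d + 1)) : ∫⁻ z in strip d, lineMajorant d u s q δ i z ≠ 0 := by
    have hlow : ENNReal.ofReal δ * ENNReal.ofReal a ≤
        ∫⁻ z in strip d, lineMajorant d u s q δ i z := by
      rw [← hua, ← lintegral_const_mul _ (by fun_prop)]
      exact lintegral_mono fun z => le_add_self
    refine (lt_of_lt_of_le ?_ hlow).ne'
    rw [← ENNReal.ofReal_mul hδ.le]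
    exact ENNReal.ofReal_pos.2 (by positivity)
  have H := lintegral_rpow_le_prod_lintegral (stripMeasure d) hconj
    (φ := fun x => ‖u (stripCoord d x)‖ₑ ^ s)
    (f := fun i x => lineMajorant d u s q δ i (stripCoord d x))
    (fun i => (measurable_lineMajorant hu s q δ i).comp (stripCoord d).continuous.measurable)
    (enorm_rpow_le_lintegral_lineMajorant hu hs1 hq0 hδ)
    (fun i => by rw [hint]; exact hne i)
    (fun i => by rw [hint]; exact ne_top_of_le_ne_top ENNReal.ofReal_ne_top (hle i))
  simp only [hint, ← ENNReal.rpow_mul, hsp] at H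
  rw [hmp.lintegral_comp (f := fun z => ‖u z‖ₑ ^ q) (by fun_prop), hua, Fintype.card_fin,
    Nat.cast_add_one, Nat.cast_add_one, add_sub_cancel_right] at H
  have hc (i : Fin (d + 1)) : 0 ≤ (if i = 0 then (2 * π)⁻¹ else 0) * (√a * √m) +
      s * (√a * √(b i)) + δ * a := by
    have : 0 ≤ (if i = 0 then (2 * π)⁻¹ else 0 : ℝ) := by split_ifs <;> positivity
    positivity
  refine (ENNReal.ofReal_le_ofReal_iff ?_).1 (H.trans ?_)
  · exact mul_nonneg (by positivity) (Finset.prod_nonneg fun i _ => Real.rpow_nonneg (hc i) _)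
  · rw [ENNReal.ofReal_mul (by positivity),
      ENNReal.ofReal_prod_of_nonneg fun i _ => Real.rpow_nonneg (hc i) _,
      ← ENNReal.ofReal_rpow_of_nonneg (by positivity) (by positivity)]
    gcongr with i
    · rw [ENNReal.ofReal_add (by positivity) zero_le_one]; simp
    · rw [← ENNReal.ofReal_rpow_of_nonneg (hc i) (by positivity)]
      gcongr
      exact hle i

/-- The inequality for a function with prescribed bounds on the norms. -/
theorem le_mul_rpow_mul_rpow_of_norms {d : ℕ} (hd : 2 ≤ d) {u : Edim d × ℝ → ℂ}
    (hu : Differentiable ℝ u) {s q a m bx bY : ℝ} (hs : s = 2 * d / ((d : ℝ) - 1))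
    (hq : q = 2 * (s - 1)) (ha : 0 ≤ a) (hm : 0 ≤ m) (hbx : 0 ≤ bx) (hbY : 0 ≤ bY)
    (hua : ∫⁻ z in strip d, ‖u z‖ₑ ^ q = ENNReal.ofReal a)
    (hum : ∫⁻ z in strip d, ‖u z‖ₑ ^ (2 : ℝ) ≤ ENNReal.ofReal m)
    (hubx : ∀ j : Fin d, ∫⁻ z in strip d,
      ‖fderiv ℝ u z (EuclideanSpace.single j 1, 0)‖ₑ ^ (2 : ℝ) ≤ ENNReal.ofReal bx)
    (hubY : ∫⁻ z in strip d, ‖fderiv ℝ u z (0, 1)‖ₑ ^ (2 : ℝ) ≤ ENNReal.ofReal bY) :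
    a ≤ (((d : ℝ) + 1) ^ (((d : ℝ) + 1) / d) * s * s ^ (1 / (d : ℝ))) ^ (2 * d / ((d : ℝ) - 1)) *
      bx ^ (d / ((d : ℝ) - 1)) * (√m + √bY) ^ (2 / ((d : ℝ) - 1)) := by
  have hD : (2 : ℝ) ≤ d := by exact_mod_cast hd
  have hD1 : (0 : ℝ) < (d : ℝ) - 1 := by linarith
  have hs1 : 1 < s := by rw [hs, lt_div_iff₀ hD1]; linarith
  rcases ha.eq_or_lt with rfl | ha'
  · positivity
  set b : Fin (d + 1) → ℝ := Fin.cons bY fun _ => bx with hb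
  have hb0 (i : Fin (d + 1)) : 0 ≤ b i := by
    induction i using Fin.cases <;> simpa [hb]
  have hub (i : Fin (d + 1)) :
      ∫⁻ z in strip d, ‖fderiv ℝ u z (stripCoord d (Pi.single i 1))‖ₑ ^ (2 : ℝ) ≤
        ENNReal.ofReal (b i) := by
    induction i using Fin.cases with
    | zero => simpa only [stripCoord_single_zero, hb, Fin.cons_zero] using hubY
    | succ j => simpa only [stripCoord_single_succ, hb, Fin.cons_succ] using hubx j
  have hlim : a ≤ ((d : ℝ) + 1) ^ (((d : ℝ) + 1) / d) * ∏ i : Fin (d + 1),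
      ((if i = 0 then (2 * π)⁻¹ else 0) * (√a * √m) + s * (√a * √(b i)) + 0 * a) ^
        (1 / (d : ℝ)) := by
    have hcont : Continuous fun δ : ℝ => ((d : ℝ) + 1) ^ (((d : ℝ) + 1) / d) *
        ∏ i : Fin (d + 1), ((if i = 0 then (2 * π)⁻¹ else 0) * (√a * √m) +
          s * (√a * √(b i)) + δ * a) ^ (1 / (d : ℝ)) := by
      refine continuous_const.mul (continuous_finsetProd _ fun i _ => ?_)
      exact Continuous.rpow_const (by fun_prop) fun _ => Or.inr (by positivity)
    refine ge_of_tendsto (hcont.tendsto 0 |>.mono_left (nhdsWithin_le_nhds (s := Ioi 0))) ?_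
    filter_upwards [self_mem_nhdsWithin] with δ hδ
    exact le_prod_directional hd hu hs hq hδ ha' hm hb0 hua hum hub
  have hprod : ∏ _j : Fin d, (s * (√a * √bx)) ^ (1 / (d : ℝ)) = s * (√a * √bx) := by
    rw [Finset.prod_const, Finset.card_univ, Fintype.card_fin,
      ← Real.rpow_mul_natCast (by positivity), one_div_mul_cancel (by positivity), Real.rpow_one]
  simp only [Fin.prod_univ_succ, if_true, Fin.succ_ne_zero, if_false, hb, Fin.cons_zero,
    Fin.cons_succ, zero_mul, add_zero, zero_add, hprod] at hlim
  have hpi : (2 * π)⁻¹ ≤ s := by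
    refine le_trans (inv_le_one_of_one_le₀ ?_) hs1.le
    linarith [Real.two_le_pi]
  refine le_of_le_mul_sqrt_mul_rpow (by linarith) (by positivity) ha hbx (by positivity)
    (hlim.trans ?_)
  calc ((d : ℝ) + 1) ^ (((d : ℝ) + 1) / d) * (((2 * π)⁻¹ * (√a * √m) + s * (√a * √bY)) ^
        (1 / (d : ℝ)) * (s * (√a * √bx)))
      ≤ ((d : ℝ) + 1) ^ (((d : ℝ) + 1) / d) * ((s * (√a * √m) + s * (√a * √bY)) ^
        (1 / (d : ℝ)) * (s * (√a * √bx))) := by gcongr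
    _ = _ := by
        rw [show s * (√a * √m) + s * (√a * √bY) = s * (√a * (√m + √bY)) by ring,
          Real.mul_rpow (by positivity) (by positivity)]
        ring

/-- Scale-invariant Gagliardo–Nirenberg inequality on `ℝ^d × 𝕋`: there is `C > 0`
(depending only on `d`) with
`‖u‖_q^q ≤ C ‖∇ₓu‖₂^{2d/(d−1)} (‖u‖₂^{2/(d−1)} + ‖∂_yu‖₂^{2/(d−1)})`,
where `q = 2(d+1)/(d−1)` and squared norms are `gradxSq`, `massF`, `gradySq`. -/
theorem gagliardo_nirenberg_scale_invariant (d : ℕ) (hd : 2 ≤ d) :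
    ∃ C : ℝ, 0 < C ∧ ∀ u : Edim d × ℝ → ℂ, InH1 d u →
      lpPow d u (qExp d)
        ≤ C * (gradxSq d u) ^ ((d : ℝ) / ((d : ℝ) - 1)) *
          ((massF d u) ^ (1 / ((d : ℝ) - 1)) + (gradySq d u) ^ (1 / ((d : ℝ) - 1))) := by
  have hD : (2 : ℝ) ≤ d := by exact_mod_cast hd
  have hD1 : (0 : ℝ) < (d : ℝ) - 1 := by linarith
  set s : ℝ := 2 * d / ((d : ℝ) - 1) with hs
  have hs0 : 0 < s := by positivity
  have hq : qExp d = 2 * (s - 1) := by rw [qExp, hs]; field_simp; ring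
  have hq0 : 0 ≤ qExp d := by unfold qExp; positivity
  set K : ℝ := (((d : ℝ) + 1) ^ (((d : ℝ) + 1) / d) * s * s ^ (1 / (d : ℝ))) ^
    (2 * d / ((d : ℝ) - 1)) with hK
  have hK0 : 0 < K := by positivity
  refine ⟨K * 2 ^ (2 * (1 / ((d : ℝ) - 1))), by positivity, fun u hu => ?_⟩
  obtain ⟨-, hdiff, hu2, hdu2, huq⟩ := hu
  have hint (v : Edim d × ℝ) :
      Integrable (fun z => ‖fderiv ℝ u z v‖ ^ 2) (volume.restrict (strip d)) := by
    refine (hdu2.mul_const (‖v‖ ^ 2)).mono'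
      ((measurable_fderiv_apply_const ℝ u v).norm.pow_const 2).aestronglyMeasurable
      (ae_of_all _ fun z => ?_)
    rw [Real.norm_of_nonneg (by positivity), ← mul_pow]
    gcongr
    exact (fderiv ℝ u z).le_opNorm v
  have hsq {f : Edim d × ℝ → ℂ} (hf : Integrable (fun z => ‖f z‖ ^ 2) (volume.restrict (strip d))) :
      ∫⁻ z in strip d, ‖f z‖ₑ ^ (2 : ℝ) = ENNReal.ofReal (∫ z in strip d, ‖f z‖ ^ 2) := by
    rw [lintegral_enorm_rpow_eq_ofReal zero_le_two (by simpa using hf)]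
    simp
  have hM : 0 ≤ massF d u := integral_nonneg fun z => by positivity
  have hX : 0 ≤ gradxSq d u := integral_nonneg fun z => by positivity
  have hY : 0 ≤ gradySq d u := integral_nonneg fun z => by positivity
  have hA : 0 ≤ lpPow d u (qExp d) := integral_nonneg fun z => by positivity
  have hgradx (j : Fin d) :
      ∫⁻ z in strip d, ‖fderiv ℝ u z (EuclideanSpace.single j 1, 0)‖ₑ ^ (2 : ℝ) ≤
        ENNReal.ofReal (gradxSq d u) := by
    rw [hsq (hint _)]
    refine ENNReal.ofReal_le_ofReal (integral_mono (hint _)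
      (integrable_finsetSum _ fun i _ => hint _) fun z => ?_)
    exact Finset.single_le_sum
      (f := fun i : Fin d => ‖fderiv ℝ u z (EuclideanSpace.single i 1, 0)‖ ^ 2)
      (fun _ _ => by positivity) (Finset.mem_univ j)
  have H := le_mul_rpow_mul_rpow_of_norms hd hdiff hs hq hA hM hX hY
    (lintegral_enorm_rpow_eq_ofReal hq0 huq) (hsq hu2).le hgradx (hsq (hint _)).le
  have hsum := sqrt_add_sqrt_rpow_le hM hY (one_div_nonneg.2 hD1.le)
  rw [show 2 / ((d : ℝ) - 1) = 2 * (1 / ((d : ℝ) - 1)) by ring] at H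
  refine H.trans ?_
  calc K * gradxSq d u ^ ((d : ℝ) / ((d : ℝ) - 1)) *
        (√(massF d u) + √(gradySq d u)) ^ (2 * (1 / ((d : ℝ) - 1)))
      ≤ K * gradxSq d u ^ ((d : ℝ) / ((d : ℝ) - 1)) * (2 ^ (2 * (1 / ((d : ℝ) - 1))) *
        (massF d u ^ (1 / ((d : ℝ) - 1)) + gradySq d u ^ (1 / ((d : ℝ) - 1)))) := by gcongr
    _ = _ := by ring
end
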